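/- arXiv:1710.02783 — 2 statements merged into one kernel-verified Lean document; each statement's English description precedes it below -/
import Mathlib

section
/- Let Ψ : (0,∞) → ℝ be smooth with ρ Ψ'(ρ) = cos Ψ(ρ) for all ρ > 0. On Ω = {x ∈ ℝ³ : x₁² + x₂² > 0}, define f(x) = π/2 − Ψ(ρ(x)) where ρ(x) = √(x₁² + x₂²), let g = θ be the azimuthal angle, and set n = (sin f cos g, sin f sin g, cos f) (equivalently, the 'escape into third dimension' director n = cos Ψ(ρ) e_ρ + sin Ψ(ρ) e_z in cylindrical coordinates). Then n satisfies the extra equation 2 Σ_{k=1}^{3} ∂_k n ⊗ ∂_k n + |∇n|² (n ⊗ n − I) = 0 on Ω, and moreover Δf − |∇g|² sin f cos f = 0 and Δg = 0 on Ω. -/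
open Real Set

noncomputable section

/-- Partial derivative in direction `i`. -/
def pd (i : Fin 3) (f : (Fin 3 → ℝ) → ℝ) (x : Fin 3 → ℝ) : ℝ :=
  fderiv ℝ f x (Pi.single i 1)

/-- Laplacian on ℝ³. -/
def lap (f : (Fin 3 → ℝ) → ℝ) (x : Fin 3 → ℝ) : ℝ :=
  ∑ i : Fin 3, pd i (fun y => pd i f y) x

/-- Kronecker delta. -/
def kron (i j : Fin 3) : ℝ := if i = j then 1 else 0

/-- `|∇n|² = Σ_{i,k} (∂_k n_i)²`. -/
def gradSq (n : (Fin 3 → ℝ) → Fin 3 → ℝ) (x : Fin 3 → ℝ) : ℝ :=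
  ∑ i : Fin 3, ∑ k : Fin 3, (pd k (fun y => n y i) x) ^ 2

/-- Cylindrical radius `ρ = √(x₁² + x₂²)`. -/
def cylRad (x : Fin 3 → ℝ) : ℝ := Real.sqrt (x 0 ^ 2 + x 1 ^ 2)

/-- The "escape into third dimension" director
`n = cos Ψ(ρ) e_ρ + sin Ψ(ρ) e_z`. -/
def escDir (Ψ : ℝ → ℝ) (x : Fin 3 → ℝ) : Fin 3 → ℝ :=
  ![Real.cos (Ψ (cylRad x)) * (x 0 / cylRad x),
    Real.cos (Ψ (cylRad x)) * (x 1 / cylRad x),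
    Real.sin (Ψ (cylRad x))]

/-- The coordinate differential `dx_i` on ℝ³. -/
def coordDiff (i : Fin 3) : (Fin 3 → ℝ) →L[ℝ] ℝ := ContinuousLinearMap.proj i

lemma coordDiff_single (i j : Fin 3) : coordDiff i (Pi.single j 1) = if i = j then 1 else 0 := by
  simp [coordDiff, Pi.single_apply]

lemma hasFDerivAt_coord (i : Fin 3) (x : Fin 3 → ℝ) :
    HasFDerivAt (fun y : Fin 3 → ℝ => y i) (coordDiff i) x :=
  (coordDiff i).hasFDerivAt

lemma HasFDerivAt.pd_eq {f : (Fin 3 → ℝ) → ℝ} {f' : (Fin 3 → ℝ) →L[ℝ] ℝ} {x : Fin 3 → ℝ}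
    (h : HasFDerivAt f f' x) (i : Fin 3) : pd i f x = f' (Pi.single i 1) := by
  rw [pd, h.fderiv]

lemma pd_congr {f g : (Fin 3 → ℝ) → ℝ} {x : Fin 3 → ℝ} (h : f =ᶠ[nhds x] g) (i : Fin 3) :
    pd i f x = pd i g x := by
  rw [pd, pd, h.fderiv_eq]

lemma cylRad_sq (x : Fin 3 → ℝ) : cylRad x ^ 2 = x 0 ^ 2 + x 1 ^ 2 :=
  Real.sq_sqrt (by positivity)

lemma cylRad_pos {x : Fin 3 → ℝ} (hx : 0 < x 0 ^ 2 + x 1 ^ 2) : 0 < cylRad x :=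
  Real.sqrt_pos.2 hx

lemma isOpen_offAxis : IsOpen {x : Fin 3 → ℝ | 0 < x 0 ^ 2 + x 1 ^ 2} :=
  isOpen_lt (by fun_prop) (by fun_prop)

section OffAxis

variable {x : Fin 3 → ℝ}

lemma hasFDerivAt_cylRad (hx : 0 < x 0 ^ 2 + x 1 ^ 2) :
    HasFDerivAt cylRad ((x 0 / cylRad x) • coordDiff 0 + (x 1 / cylRad x) • coordDiff 1) x := by
  have h := (((hasFDerivAt_coord 0 x).pow 2).add ((hasFDerivAt_coord 1 x).pow 2)).sqrt hx.ne'
  refine HasFDerivAt.congr_fderiv h ?_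
  have := (cylRad_pos hx).ne'
  ext v
  simp only [cylRad, Pi.add_apply, one_div, smul_apply, add_apply, smul_eq_mul] at this ⊢
  simp
  field_simp

lemma hasFDerivAt_coord_div_cylRad (hx : 0 < x 0 ^ 2 + x 1 ^ 2) (i : Fin 3) :
    HasFDerivAt (fun y => y i / cylRad y)
      ((1 / cylRad x) • coordDiff i - (x i / cylRad x ^ 3) •
        (x 0 • coordDiff 0 + x 1 • coordDiff 1)) x := by
  have hρ := (cylRad_pos hx).ne'
  simp only [div_eq_mul_inv (_ : ℝ)]
  refine ((hasFDerivAt_coord i x).fun_mul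
    ((hasDerivAt_inv hρ).comp_hasFDerivAt x (hasFDerivAt_cylRad hx))).congr_fderiv ?_
  ext v
  simp
  field_simp
  ring

lemma hasFDerivAt_coord_div_cylRad_sq (hx : 0 < x 0 ^ 2 + x 1 ^ 2) (i : Fin 3) :
    HasFDerivAt (fun y => y i / cylRad y ^ 2)
      ((1 / cylRad x ^ 2) • coordDiff i - (2 * x i / cylRad x ^ 4) •
        (x 0 • coordDiff 0 + x 1 • coordDiff 1)) x := by
  have hρ := (cylRad_pos hx).ne'
  simp only [div_eq_mul_inv (_ : ℝ)]
  refine ((hasFDerivAt_coord i x).fun_mul ((hasDerivAt_inv (pow_ne_zero 2 hρ)).comp_hasFDerivAt x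
    ((hasFDerivAt_cylRad hx).pow 2))).congr_fderiv ?_
  ext v
  simp
  field_simp
  ring

/-- A function whose sine and cosine are those of the azimuthal angle has the expected gradient. -/
lemma hasFDerivAt_angle {g : (Fin 3 → ℝ) → ℝ} (hx : 0 < x 0 ^ 2 + x 1 ^ 2)
    (hg : DifferentiableAt ℝ g x)
    (hcos : (fun y => Real.cos (g y)) =ᶠ[nhds x] fun y => y 0 / cylRad y)
    (hsin : (fun y => Real.sin (g y)) =ᶠ[nhds x] fun y => y 1 / cylRad y) :
    HasFDerivAt g ((x 0 / cylRad x ^ 2) • coordDiff 1 - (x 1 / cylRad x ^ 2) • coordDiff 0) x := by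
  have hρ := (cylRad_pos hx).ne'
  have hc := hg.hasFDerivAt.cos.unique
    ((hasFDerivAt_coord_div_cylRad hx 0).congr_of_eventuallyEq hcos)
  have hs := hg.hasFDerivAt.sin.unique
    ((hasFDerivAt_coord_div_cylRad hx 1).congr_of_eventuallyEq hsin)
  refine hg.hasFDerivAt.congr_fderiv ?_
  ext v
  have hcv := DFunLike.congr_fun hc v
  have hsv := DFunLike.congr_fun hs v
  have hc0 : Real.cos (g x) = _ := hcos.self_of_nhds
  have hs0 : Real.sin (g x) = _ := hsin.self_of_nhds
  have h1 := Real.sin_sq_add_cos_sq (g x)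
  simp only [smul_apply, sub_apply, add_apply, smul_eq_mul] at hcv hsv ⊢
  have key : fderiv ℝ g x v = Real.cos (g x) * (Real.cos (g x) * fderiv ℝ g x v)
      - Real.sin (g x) * (-Real.sin (g x) * fderiv ℝ g x v) := by
    linear_combination -(fderiv ℝ g x v) * h1
  rw [key, hcv, hsv, hc0, hs0]
  field_simp
  ring

lemma lap_angle_and_gradient {g : (Fin 3 → ℝ) → ℝ} {U : Set (Fin 3 → ℝ)} (hU : IsOpen U)
    (hxU : x ∈ U) (hpos : ∀ y ∈ U, 0 < y 0 ^ 2 + y 1 ^ 2) (hg : DifferentiableOn ℝ g U)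
    (hangle : ∀ y ∈ U, Real.cos (g y) = y 0 / cylRad y ∧ Real.sin (g y) = y 1 / cylRad y) :
    lap g x = 0 ∧ ∑ k : Fin 3, pd k g x ^ 2 = 1 / cylRad x ^ 2 := by
  have hD (y : Fin 3 → ℝ) (hy : y ∈ U) := hasFDerivAt_angle (hpos y hy)
    (hg.differentiableAt (hU.mem_nhds hy))
    ((hU.eventually_mem hy).mono fun z hz => (hangle z hz).1)
    ((hU.eventually_mem hy).mono fun z hz => (hangle z hz).2)
  have hx := hpos x hxU
  have hρ := (cylRad_pos hx).ne'
  have hr := cylRad_sq x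
  have h0 : (fun y => pd 0 g y) =ᶠ[nhds x] fun y => -(y 1 / cylRad y ^ 2) :=
    (hU.eventually_mem hxU).mono fun y hy => by simp [(hD y hy).pd_eq, coordDiff_single]
  have h1 : (fun y => pd 1 g y) =ᶠ[nhds x] fun y => y 0 / cylRad y ^ 2 :=
    (hU.eventually_mem hxU).mono fun y hy => by simp [(hD y hy).pd_eq, coordDiff_single]
  have h2 : (fun y => pd 2 g y) =ᶠ[nhds x] fun _ => 0 :=
    (hU.eventually_mem hxU).mono fun y hy => by simp [(hD y hy).pd_eq, coordDiff_single]
  constructor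
  · rw [lap, Fin.sum_univ_three, pd_congr h0, pd_congr h1, pd_congr h2,
      (hasFDerivAt_coord_div_cylRad_sq hx 1).fun_neg.pd_eq,
      (hasFDerivAt_coord_div_cylRad_sq hx 0).pd_eq, (hasFDerivAt_const (0 : ℝ) x).pd_eq]
    simp [coordDiff_single]
    ring
  · rw [Fin.sum_univ_three, show pd 0 g x = _ from h0.self_of_nhds,
      show pd 1 g x = _ from h1.self_of_nhds, show pd 2 g x = _ from h2.self_of_nhds]
    field_simp
    linear_combination -hr

end OffAxis

section Escape

variable {Ψ : ℝ → ℝ} {x : Fin 3 → ℝ}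

lemma hasFDerivAt_profile (hΨ : DifferentiableOn ℝ Ψ (Ioi 0))
    (hODE : ∀ ρ : ℝ, 0 < ρ → ρ * deriv Ψ ρ = Real.cos (Ψ ρ)) (hx : 0 < x 0 ^ 2 + x 1 ^ 2) :
    HasFDerivAt (fun y => Ψ (cylRad y))
      ((Real.cos (Ψ (cylRad x)) / cylRad x ^ 2) •
        (x 0 • coordDiff 0 + x 1 • coordDiff 1)) x := by
  have hρ := cylRad_pos hx
  have hd : HasDerivAt Ψ (deriv Ψ (cylRad x)) (cylRad x) :=
    (hΨ.differentiableAt (Ioi_mem_nhds hρ)).hasDerivAt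
  refine (hd.comp_hasFDerivAt x (hasFDerivAt_cylRad hx)).congr_fderiv ?_
  rw [← hODE _ hρ]
  ext v
  simp
  field_simp

lemma lap_tilt (hΨ : DifferentiableOn ℝ Ψ (Ioi 0))
    (hODE : ∀ ρ : ℝ, 0 < ρ → ρ * deriv Ψ ρ = Real.cos (Ψ ρ)) (hx : 0 < x 0 ^ 2 + x 1 ^ 2) :
    lap (fun y => π / 2 - Ψ (cylRad y)) x =
      Real.sin (Ψ (cylRad x)) * Real.cos (Ψ (cylRad x)) / cylRad x ^ 2 := by
  have hD (y : Fin 3 → ℝ) (hy : 0 < y 0 ^ 2 + y 1 ^ 2) :=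
    (hasFDerivAt_profile hΨ hODE hy).const_sub (π / 2)
  have hr := cylRad_sq x
  have hρ := (cylRad_pos hx).ne'
  have h (i : Fin 3) : (fun y => pd i (fun y => π / 2 - Ψ (cylRad y)) y) =ᶠ[nhds x]
      fun y => if i = 2 then 0 else -(Real.cos (Ψ (cylRad y)) * (y i / cylRad y ^ 2)) := by
    filter_upwards [isOpen_offAxis.eventually_mem hx] with y hy
    rw [(hD y hy).pd_eq]
    fin_cases i <;> simp [coordDiff_single] <;> ring
  have hE (i : Fin 3) := ((hasFDerivAt_profile hΨ hODE hx).cos.fun_mul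
    (hasFDerivAt_coord_div_cylRad_sq hx i)).fun_neg
  rw [lap, Fin.sum_univ_three, pd_congr (h 0), pd_congr (h 1), pd_congr (h 2)]
  simp only [Fin.reduceEq, if_false, if_true]
  rw [(hE 0).pd_eq, (hE 1).pd_eq, (hasFDerivAt_const (0 : ℝ) x).pd_eq]
  simp [coordDiff_single]
  generalize Real.sin (Ψ (cylRad x)) = S at *
  generalize Real.cos (Ψ (cylRad x)) = C at *
  field_simp
  grind

lemma pd_escDir (hΨ : DifferentiableOn ℝ Ψ (Ioi 0))
    (hODE : ∀ ρ : ℝ, 0 < ρ → ρ * deriv Ψ ρ = Real.cos (Ψ ρ)) (hx : 0 < x 0 ^ 2 + x 1 ^ 2)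
    (i k : Fin 3) :
    pd k (fun y => escDir Ψ y i) x = Real.cos (Ψ (cylRad x)) / cylRad x *
      !![1 - (1 + Real.sin (Ψ (cylRad x))) * (x 0 / cylRad x) ^ 2,
          -(1 + Real.sin (Ψ (cylRad x))) * (x 0 / cylRad x) * (x 1 / cylRad x), 0;
        -(1 + Real.sin (Ψ (cylRad x))) * (x 0 / cylRad x) * (x 1 / cylRad x),
          1 - (1 + Real.sin (Ψ (cylRad x))) * (x 1 / cylRad x) ^ 2, 0;
        Real.cos (Ψ (cylRad x)) * (x 0 / cylRad x),
          Real.cos (Ψ (cylRad x)) * (x 1 / cylRad x), 0] i k := by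
  have hρ := (cylRad_pos hx).ne'
  have hP := hasFDerivAt_profile hΨ hODE hx
  have h0 : HasFDerivAt (fun y => escDir Ψ y 0) _ x :=
    hP.cos.mul (hasFDerivAt_coord_div_cylRad hx 0)
  have h1 : HasFDerivAt (fun y => escDir Ψ y 1) _ x :=
    hP.cos.mul (hasFDerivAt_coord_div_cylRad hx 1)
  have h2 : HasFDerivAt (fun y => escDir Ψ y 2) _ x := hP.sin
  fin_cases i
  · refine (h0.pd_eq k).trans ?_
    fin_cases k <;> simp [coordDiff_single] <;> field_simp <;> ring
  · refine (h1.pd_eq k).trans ?_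
    fin_cases k <;> simp [coordDiff_single] <;> field_simp <;> ring
  · refine (h2.pd_eq k).trans ?_
    fin_cases k <;> simp [coordDiff_single] <;> field_simp

lemma escDir_extra_equation (hΨ : DifferentiableOn ℝ Ψ (Ioi 0))
    (hODE : ∀ ρ : ℝ, 0 < ρ → ρ * deriv Ψ ρ = Real.cos (Ψ ρ)) (hx : 0 < x 0 ^ 2 + x 1 ^ 2)
    (i j : Fin 3) :
    2 * (∑ k : Fin 3, pd k (fun y => escDir Ψ y i) x * pd k (fun y => escDir Ψ y j) x)
      + gradSq (escDir Ψ) x * (escDir Ψ x i * escDir Ψ x j - kron i j) = 0 := by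
  have hρ := (cylRad_pos hx).ne'
  have hab : (x 0 / cylRad x) ^ 2 + (x 1 / cylRad x) ^ 2 = 1 := by
    field_simp
    exact (cylRad_sq x).symm
  have hSC := Real.sin_sq_add_cos_sq (Ψ (cylRad x))
  have hG : gradSq (escDir Ψ) x = 2 * (Real.cos (Ψ (cylRad x)) / cylRad x) ^ 2 := by
    simp only [gradSq, Fin.sum_univ_three, pd_escDir hΨ hODE hx]
    generalize Real.cos (Ψ (cylRad x)) / cylRad x = q at *
    generalize Real.sin (Ψ (cylRad x)) = S at *
    generalize Real.cos (Ψ (cylRad x)) = C at *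
    generalize x 0 / cylRad x = a at *
    generalize x 1 / cylRad x = b at *
    simp
    grind
  rw [hG]
  simp only [Fin.sum_univ_three, pd_escDir hΨ hODE hx]
  simp only [escDir, kron]
  generalize Real.cos (Ψ (cylRad x)) / cylRad x = q at *
  generalize Real.sin (Ψ (cylRad x)) = S at *
  generalize Real.cos (Ψ (cylRad x)) = C at *
  generalize x 0 / cylRad x = a at *
  generalize x 1 / cylRad x = b at *
  fin_cases i <;> fin_cases j <;> simp <;> grind

end Escape

/-- the escape-into-third-dimension director satisfies the extra equation
`2 Σ_k ∂_k n ⊗ ∂_k n + |∇n|² (n⊗n − I) = 0` on `Ω = {x : x₁² + x₂² > 0}`; moreover, with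
`f = π/2 − Ψ(ρ)` and `g` any local smooth branch of the azimuthal angle `θ`, one has
`Δf − |∇g|² sin f cos f = 0` and `Δg = 0` on Ω. -/
theorem stmt6 (Ψ : ℝ → ℝ)
    (hΨ : ContDiffOn ℝ (⊤ : ℕ∞) Ψ (Ioi 0))
    (hODE : ∀ ρ : ℝ, 0 < ρ → ρ * deriv Ψ ρ = Real.cos (Ψ ρ))
    (Ω : Set (Fin 3 → ℝ)) (hΩdef : Ω = {x : Fin 3 → ℝ | x 0 ^ 2 + x 1 ^ 2 > 0})
    (f : (Fin 3 → ℝ) → ℝ) (hfdef : ∀ x : Fin 3 → ℝ, f x = π / 2 - Ψ (cylRad x)) :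
    ∀ x ∈ Ω,
      (∀ i j : Fin 3,
          2 * (∑ k : Fin 3,
                pd k (fun y => escDir Ψ y i) x * pd k (fun y => escDir Ψ y j) x)
            + gradSq (escDir Ψ) x * (escDir Ψ x i * escDir Ψ x j - kron i j) = 0)
      ∧ (∀ (g : (Fin 3 → ℝ) → ℝ) (U : Set (Fin 3 → ℝ)),
          IsOpen U → x ∈ U → U ⊆ Ω → ContDiffOn ℝ (⊤ : ℕ∞) g U →
          (∀ y ∈ U, Real.cos (g y) = y 0 / cylRad y ∧ Real.sin (g y) = y 1 / cylRad y) →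
          lap g x = 0
            ∧ lap f x
                - (∑ k : Fin 3, (pd k g x) ^ 2) * Real.sin (f x) * Real.cos (f x)
              = 0) := by
  intro x hxΩ
  subst hΩdef
  obtain rfl : f = fun y => π / 2 - Ψ (cylRad y) := funext hfdef
  have hd : DifferentiableOn ℝ Ψ (Ioi 0) := hΨ.differentiableOn (by simp)
  have hx : 0 < x 0 ^ 2 + x 1 ^ 2 := hxΩ
  refine ⟨escDir_extra_equation hd hODE hx, fun g U hU hxU hUΩ hg hangle => ?_⟩
  obtain ⟨hlap, hgrad⟩ := lap_angle_and_gradient hU hxU (fun y hy => hUΩ hy)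
    (hg.differentiableOn (by simp)) hangle
  refine ⟨hlap, ?_⟩
  rw [hgrad, lap_tilt hd hODE hx, Real.sin_pi_div_two_sub, Real.cos_pi_div_two_sub]
  ring

end
end

section
/- Given smooth pairwise orthonormal unit-vector fields n, m, p : Ω → S² on an open set Ω ⊆ ℝ³ with n satisfying the extra equation, and smooth scalar fields s, β, the field Q = s (n⊗n − (1/3)I) + β (m⊗m − p⊗p) satisfies pointwise |∇Q|² = (2/3) |∇s|² + 2 |∇β|² + 2 s² |∇n|² + 2 β² (|∇n|² + 4 |(∇m)ᵀp|²), where |∇Q|² = Σ_{i,j,k} (∂_k Q_ij)² and (∇m)ᵀp is the vector field with components Σ_i (∂_j m_i) p_i. -/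
open Real Set

noncomputable section

/-- `Q = s (n⊗n − I/3) + β (m⊗m − p⊗p)`. -/
def biQ (s β : (Fin 3 → ℝ) → ℝ) (n m p : (Fin 3 → ℝ) → Fin 3 → ℝ)
    (x : Fin 3 → ℝ) (i j : Fin 3) : ℝ :=
  s x * (n x i * n x j - kron i j / 3) + β x * (m x i * m x j - p x i * p x j)

/-- `|(∇m)ᵀ p|²`, where `((∇m)ᵀp)_j = Σ_i (∂_j m_i) p_i`. -/
def gradMTp (m p : (Fin 3 → ℝ) → Fin 3 → ℝ) (x : Fin 3 → ℝ) : ℝ :=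
  ∑ j : Fin 3, (∑ i : Fin 3, pd j (fun y => m y i) x * p x i) ^ 2

theorem pd_mul {f g : (Fin 3 → ℝ) → ℝ} {x : Fin 3 → ℝ} (k : Fin 3)
    (hf : DifferentiableAt ℝ f x) (hg : DifferentiableAt ℝ g x) :
    pd k (fun y => f y * g y) x = pd k f x * g x + f x * pd k g x := by
  simp only [pd]
  rw [fderiv_fun_mul hf hg]
  simp only [add_apply, smul_apply, smul_eq_mul]
  ring

theorem pd_add {f g : (Fin 3 → ℝ) → ℝ} {x : Fin 3 → ℝ} (k : Fin 3)
    (hf : DifferentiableAt ℝ f x) (hg : DifferentiableAt ℝ g x) :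
    pd k (fun y => f y + g y) x = pd k f x + pd k g x := by
  simp only [pd]
  rw [fderiv_fun_add hf hg, add_apply]

theorem pd_sub {f g : (Fin 3 → ℝ) → ℝ} {x : Fin 3 → ℝ} (k : Fin 3)
    (hf : DifferentiableAt ℝ f x) (hg : DifferentiableAt ℝ g x) :
    pd k (fun y => f y - g y) x = pd k f x - pd k g x := by
  simp only [pd]
  rw [fderiv_fun_sub hf hg, sub_apply]

theorem pd_const (k : Fin 3) (c : ℝ) (x : Fin 3 → ℝ) : pd k (fun _ => c) x = 0 := by
  simp [pd]

theorem differentiableAt_coord {Ω : Set (Fin 3 → ℝ)} (hΩ : IsOpen Ω)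
    {f : (Fin 3 → ℝ) → Fin 3 → ℝ} (hf : ContDiffOn ℝ (⊤ : ℕ∞) f Ω) {x : Fin 3 → ℝ} (hx : x ∈ Ω)
    (i : Fin 3) : DifferentiableAt ℝ (fun y => f y i) x :=
  differentiableAt_pi.1
    ((hf.contDiffAt (hΩ.mem_nhds hx)).differentiableAt (by simp)) i

/-- Leibniz rule for a pointwise scalar product which is constant on an open set. -/
theorem sum_pd_mul_add_mul_pd_eq_zero {Ω : Set (Fin 3 → ℝ)} (hΩ : IsOpen Ω)
    {f g : (Fin 3 → ℝ) → Fin 3 → ℝ} {c : ℝ} {x : Fin 3 → ℝ} (hx : x ∈ Ω)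
    (hf : ∀ i, DifferentiableAt ℝ (fun y => f y i) x)
    (hg : ∀ i, DifferentiableAt ℝ (fun y => g y i) x)
    (hfg : ∀ y ∈ Ω, ∑ i, f y i * g y i = c) (k : Fin 3) :
    ∑ i, (pd k (fun y => f y i) x * g x i + f x i * pd k (fun y => g y i) x) = 0 := by
  have hconst : pd k (fun y => ∑ i, f y i * g y i) x = 0 := by
    have h : (fun y => ∑ i, f y i * g y i) =ᶠ[nhds x] fun _ => c :=
      Filter.eventually_of_mem (hΩ.mem_nhds hx) hfg
    rw [pd, h.fderiv_eq]
    exact pd_const k c x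
  have hsum : pd k (fun y => ∑ i, f y i * g y i) x = ∑ i, pd k (fun y => f y i * g y i) x := by
    simp only [pd]
    rw [fderiv_fun_sum fun i _ => (hf i).fun_mul (hg i), sum_apply]
  rw [← hconst, hsum]
  exact Finset.sum_congr rfl fun i _ => (pd_mul k (hf i) (hg i)).symm

theorem pd_biQ {s β : (Fin 3 → ℝ) → ℝ} {n m p : (Fin 3 → ℝ) → Fin 3 → ℝ} {x : Fin 3 → ℝ}
    (hs : DifferentiableAt ℝ s x) (hβ : DifferentiableAt ℝ β x)
    (hn : ∀ i, DifferentiableAt ℝ (fun y => n y i) x)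
    (hm : ∀ i, DifferentiableAt ℝ (fun y => m y i) x)
    (hp : ∀ i, DifferentiableAt ℝ (fun y => p y i) x) (i j k : Fin 3) :
    pd k (fun y => biQ s β n m p y i j) x =
      pd k s x * (n x i * n x j - kron i j / 3)
        + s x * (pd k (fun y => n y i) x * n x j + n x i * pd k (fun y => n y j) x)
        + pd k β x * (m x i * m x j - p x i * p x j)
        + β x * (pd k (fun y => m y i) x * m x j + m x i * pd k (fun y => m y j) x
          - pd k (fun y => p y i) x * p x j - p x i * pd k (fun y => p y j) x) := by
  have hnn := (hn i).fun_mul (hn j)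
  have hmm := (hm i).fun_mul (hm j)
  have hpp := (hp i).fun_mul (hp j)
  have hc : DifferentiableAt ℝ (fun _ : Fin 3 → ℝ => kron i j / 3) x :=
    differentiableAt_const _
  simp only [biQ]
  rw [pd_add k (hs.fun_mul (hnn.fun_sub hc)) (hβ.fun_mul (hmm.fun_sub hpp)),
    pd_mul k hs (hnn.fun_sub hc), pd_mul k hβ (hmm.fun_sub hpp), pd_sub k hnn hc,
    pd_sub k hmm hpp, pd_const, pd_mul k (hn i) (hn j), pd_mul k (hm i) (hm j),
    pd_mul k (hp i) (hp j)]
  ring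

/-- The squared Frobenius norm is invariant under orthogonal conjugation. -/
theorem sum_sq_transpose_mul_mul {ι : Type*} [Fintype ι] [DecidableEq ι] (A D : Matrix ι ι ℝ)
    (hA : A * A.transpose = 1) :
    ∑ i, ∑ j, (A.transpose * D * A) i j ^ 2 = ∑ i, ∑ j, D i j ^ 2 := by
  have htr (M : Matrix ι ι ℝ) : ∑ i, ∑ j, M i j ^ 2 = (M * M.transpose).trace := by
    simp [Matrix.trace, Matrix.mul_apply, sq]
  have hmul : A.transpose * D * A * (A.transpose * D * A).transpose
      = A.transpose * (D * D.transpose * A) := by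
    simp only [Matrix.transpose_mul, Matrix.transpose_transpose, Matrix.mul_assoc]
    rw [← Matrix.mul_assoc A A.transpose, hA, Matrix.one_mul]
  rw [htr, htr, hmul, Matrix.trace_mul_comm, Matrix.mul_assoc, hA, Matrix.mul_one]

/-- Completeness of an orthonormal triple in `ℝ³`. -/
theorem kron_eq_of_orthonormal {n m p : Fin 3 → ℝ}
    (hA : Matrix.of ![n, m, p] * (Matrix.of ![n, m, p]).transpose = 1) (i j : Fin 3) :
    kron i j = n i * n j + m i * m j + p i * p j := by
  have h := congrArg (fun M : Matrix (Fin 3) (Fin 3) ℝ => M i j) (mul_eq_one_comm.1 hA)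
  simp only [Matrix.mul_apply, Matrix.transpose_apply, Fin.sum_univ_three, Matrix.of_apply,
    Matrix.cons_val, Matrix.one_apply] at h
  exact h.symm

theorem eq_sum_mul_of_orthonormal {n m p : Fin 3 → ℝ}
    (hA : Matrix.of ![n, m, p] * (Matrix.of ![n, m, p]).transpose = 1) (v : Fin 3 → ℝ)
    (i : Fin 3) :
    v i = (∑ l, v l * n l) * n i + (∑ l, v l * m l) * m i + (∑ l, v l * p l) * p i := by
  have h : v i = ∑ l, kron i l * v l := by simp [kron]
  rw [h]
  simp only [kron_eq_of_orthonormal hA, Fin.sum_univ_three]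
  ring

/-- The squared norm of a variation of `s (n⊗n − I/3) + β (m⊗m − p⊗p)`, in terms of the
coefficients of the corresponding variation of the orthonormal frame. -/
theorem sum_sq_biaxial_variation {n m p n' m' p' : Fin 3 → ℝ} (s β s' β' a b c : ℝ)
    (hA : Matrix.of ![n, m, p] * (Matrix.of ![n, m, p]).transpose = 1)
    (hn' : ∀ i, n' i = a * m i + b * p i)
    (hm' : ∀ i, m' i = -a * n i + c * p i)
    (hp' : ∀ i, p' i = -b * n i - c * m i) :
    ∑ i, ∑ j, (s' * (n i * n j - kron i j / 3) + s * (n' i * n j + n i * n' j)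
        + β' * (m i * m j - p i * p j)
        + β * (m' i * m j + m i * m' j - p' i * p j - p i * p' j)) ^ 2
      = 2 / 3 * s' ^ 2 + 2 * β' ^ 2 + 2 * (s - β) ^ 2 * a ^ 2 + 2 * (s + β) ^ 2 * b ^ 2
        + 8 * β ^ 2 * c ^ 2 := by
  have h := sum_sq_transpose_mul_mul _
    !![2 / 3 * s', (s - β) * a, (s + β) * b;
      (s - β) * a, β' - s' / 3, 2 * β * c;
      (s + β) * b, 2 * β * c, -β' - s' / 3] hA
  trans
  · refine Eq.trans (Finset.sum_congr rfl fun i _ => Finset.sum_congr rfl fun j _ => ?_) h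
    congr 1
    rw [kron_eq_of_orthonormal hA, hn' i, hn' j, hm' i, hm' j, hp' i, hp' j]
    simp only [Matrix.mul_apply, Matrix.transpose_apply, Fin.sum_univ_three, Matrix.of_apply,
      Matrix.cons_val]
    ring
  · simp only [Fin.sum_univ_three, Matrix.of_apply, Matrix.cons_val]
    ring

/-- Contraction of the extra equation with a unit vector orthogonal to `n`. -/
theorem two_mul_sum_sq_eq_gradSq {n : (Fin 3 → ℝ) → Fin 3 → ℝ} {x : Fin 3 → ℝ}
    (hextra : ∀ i j : Fin 3,
      2 * (∑ k : Fin 3, pd k (fun y => n y i) x * pd k (fun y => n y j) x)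
        + gradSq n x * (n x i * n x j - kron i j) = 0)
    {v : Fin 3 → ℝ} (hv : ∑ i, v i ^ 2 = 1) (hnv : ∑ i, n x i * v i = 0) :
    2 * ∑ k, (∑ i, pd k (fun y => n y i) x * v i) ^ 2 = gradSq n x := by
  have h : ∑ i, ∑ j, v i * v j *
      (2 * (∑ k : Fin 3, pd k (fun y => n y i) x * pd k (fun y => n y j) x)
        + gradSq n x * (n x i * n x j - kron i j)) = 0 := by
    simp only [hextra, mul_zero, Finset.sum_const_zero]
  simp only [Fin.sum_univ_three, kron, Fin.isValue, Fin.reduceEq, if_true, if_false] at h hv hnv ⊢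
  linear_combination h + gradSq n x * hv
    - gradSq n x * (n x 0 * v 0 + n x 1 * v 1 + n x 2 * v 2) * hnv

/-- for smooth pairwise orthonormal fields `n, m, p` with `n` satisfying the
extra equation, and smooth scalars `s, β`, the field `Q = s(n⊗n − I/3) + β(m⊗m − p⊗p)`
satisfies `|∇Q|² = (2/3)|∇s|² + 2|∇β|² + 2s²|∇n|² + 2β²(|∇n|² + 4|(∇m)ᵀp|²)` pointwise. -/
theorem stmt9 (Ω : Set (Fin 3 → ℝ)) (hΩ : IsOpen Ω)
    (n m p : (Fin 3 → ℝ) → Fin 3 → ℝ) (s β : (Fin 3 → ℝ) → ℝ)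
    (hn : ContDiffOn ℝ (⊤ : ℕ∞) n Ω)
    (hm : ContDiffOn ℝ (⊤ : ℕ∞) m Ω)
    (hp : ContDiffOn ℝ (⊤ : ℕ∞) p Ω)
    (hs : ContDiffOn ℝ (⊤ : ℕ∞) s Ω)
    (hβ : ContDiffOn ℝ (⊤ : ℕ∞) β Ω)
    (hnn : ∀ x ∈ Ω, ∑ i : Fin 3, n x i ^ 2 = 1)
    (hmm : ∀ x ∈ Ω, ∑ i : Fin 3, m x i ^ 2 = 1)
    (hpp : ∀ x ∈ Ω, ∑ i : Fin 3, p x i ^ 2 = 1)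
    (hnm : ∀ x ∈ Ω, ∑ i : Fin 3, n x i * m x i = 0)
    (hnp : ∀ x ∈ Ω, ∑ i : Fin 3, n x i * p x i = 0)
    (hmp : ∀ x ∈ Ω, ∑ i : Fin 3, m x i * p x i = 0)
    (hextra : ∀ x ∈ Ω, ∀ i j : Fin 3,
      2 * (∑ k : Fin 3, pd k (fun y => n y i) x * pd k (fun y => n y j) x)
        + gradSq n x * (n x i * n x j - kron i j) = 0) :
    ∀ x ∈ Ω,
      (∑ i : Fin 3, ∑ j : Fin 3, ∑ k : Fin 3,
          (pd k (fun y => biQ s β n m p y i j) x) ^ 2)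
        = (2/3) * (∑ k : Fin 3, (pd k s x) ^ 2)
          + 2 * (∑ k : Fin 3, (pd k β x) ^ 2)
          + 2 * s x ^ 2 * gradSq n x
          + 2 * β x ^ 2 * (gradSq n x + 4 * gradMTp m p x) := by
  intro x hx
  have hn' := differentiableAt_coord hΩ hn hx
  have hm' := differentiableAt_coord hΩ hm hx
  have hp' := differentiableAt_coord hΩ hp hx
  have hs' := (hs.contDiffAt (hΩ.mem_nhds hx)).differentiableAt (by simp)
  have hβ' := (hβ.contDiffAt (hΩ.mem_nhds hx)).differentiableAt (by simp)
  have hA : Matrix.of ![n x, m x, p x] * (Matrix.of ![n x, m x, p x]).transpose = 1 := by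
    have h1 := hnn x hx
    have h2 := hmm x hx
    have h3 := hpp x hx
    have h4 := hnm x hx
    have h5 := hnp x hx
    have h6 := hmp x hx
    simp only [Fin.sum_univ_three] at h1 h2 h3 h4 h5 h6
    ext i j
    fin_cases i <;> fin_cases j <;>
      simp [Matrix.mul_apply, Fin.sum_univ_three] <;> linarith
  have dnn := sum_pd_mul_add_mul_pd_eq_zero hΩ hx hn' hn' (c := 1) (by simpa only [sq] using hnn)
  have dmm := sum_pd_mul_add_mul_pd_eq_zero hΩ hx hm' hm' (c := 1) (by simpa only [sq] using hmm)
  have dpp := sum_pd_mul_add_mul_pd_eq_zero hΩ hx hp' hp' (c := 1) (by simpa only [sq] using hpp)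
  have dnm := sum_pd_mul_add_mul_pd_eq_zero hΩ hx hn' hm' hnm
  have dnp := sum_pd_mul_add_mul_pd_eq_zero hΩ hx hn' hp' hnp
  have dmp := sum_pd_mul_add_mul_pd_eq_zero hΩ hx hm' hp' hmp
  simp only [Fin.sum_univ_three] at dnn dmm dpp dnm dnp dmp
  have hk (k : Fin 3) : ∑ i, ∑ j, pd k (fun y => biQ s β n m p y i j) x ^ 2 =
      2 / 3 * pd k s x ^ 2 + 2 * pd k β x ^ 2
        + 2 * (s x - β x) ^ 2 * (∑ i, pd k (fun y => n y i) x * m x i) ^ 2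
        + 2 * (s x + β x) ^ 2 * (∑ i, pd k (fun y => n y i) x * p x i) ^ 2
        + 8 * β x ^ 2 * (∑ i, pd k (fun y => m y i) x * p x i) ^ 2 := by
    simp only [pd_biQ hs' hβ' hn' hm' hp']
    refine sum_sq_biaxial_variation (n' := fun i => pd k (fun y => n y i) x)
      (m' := fun i => pd k (fun y => m y i) x) (p' := fun i => pd k (fun y => p y i) x)
      _ _ _ _ _ _ _ hA (fun i => ?_) (fun i => ?_) (fun i => ?_)
    · refine (eq_sum_mul_of_orthonormal hA (fun l => pd k (fun y => n y l) x) i).trans ?_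
      simp only [Fin.sum_univ_three]
      linear_combination n x i / 2 * dnn k
    · refine (eq_sum_mul_of_orthonormal hA (fun l => pd k (fun y => m y l) x) i).trans ?_
      simp only [Fin.sum_univ_three]
      linear_combination m x i / 2 * dmm k + n x i * dnm k
    · refine (eq_sum_mul_of_orthonormal hA (fun l => pd k (fun y => p y l) x) i).trans ?_
      simp only [Fin.sum_univ_three]
      linear_combination p x i / 2 * dpp k + n x i * dnp k + m x i * dmp k
  have ha := two_mul_sum_sq_eq_gradSq (hextra x hx) (hmm x hx) (hnm x hx)
  have hb := two_mul_sum_sq_eq_gradSq (hextra x hx) (hpp x hx) (hnp x hx)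
  have hswap : ∑ i : Fin 3, ∑ j : Fin 3, ∑ k : Fin 3, pd k (fun y => biQ s β n m p y i j) x ^ 2
      = ∑ k : Fin 3, ∑ i : Fin 3, ∑ j : Fin 3, pd k (fun y => biQ s β n m p y i j) x ^ 2 := by
    rw [Finset.sum_comm]
    refine (Finset.sum_congr rfl fun i _ => Finset.sum_comm).trans ?_
    rw [Finset.sum_comm]
    exact Finset.sum_congr rfl fun k _ => Finset.sum_comm
  rw [hswap]
  simp only [hk, Finset.sum_add_distrib, ← Finset.mul_sum]
  rw [gradMTp]
  linear_combination (s x - β x) ^ 2 * ha + (s x + β x) ^ 2 * hb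

end
end
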